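/- Let c > 0 and let L be a nonnegative integer satisfying (1-α)^{L+1} ≤ cα/(2n). Then for every vertex t, the truncated PageRank π̄_L(t) = (1/n)·∑_{s∈V} ∑_{ℓ=0}^{L} π_s^{(ℓ)}(t) satisfies π̄_L(t) ≤ π(t) ≤ π̄_L(t) + (c/2)·π(t). -/

import Mathlib

open Matrix Finset

noncomputable def transP {V : Type*} [Fintype V] [DecidableEq V]
    (G : SimpleGraph V) [DecidableRel G.Adj] : Matrix V V ℝ :=
  G.adjMatrix ℝ * (Matrix.diagonal fun u : V => (G.degree u : ℝ))⁻¹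

noncomputable def pagerank {V : Type*} [Fintype V] [DecidableEq V]
    (G : SimpleGraph V) [DecidableRel G.Adj] (α : ℝ) : V → ℝ :=
  ∑' i : ℕ, (α * (1 - α) ^ i) • ((transP G ^ i) *ᵥ fun _ : V => 1 / (Fintype.card V : ℝ))

noncomputable def pprHop {V : Type*} [Fintype V] [DecidableEq V]
    (G : SimpleGraph V) [DecidableRel G.Adj] (α : ℝ) (s : V) (ℓ : ℕ) : V → ℝ :=
  (α * (1 - α) ^ ℓ) • ((transP G ^ ℓ) *ᵥ Pi.single s 1)

noncomputable def ppr {V : Type*} [Fintype V] [DecidableEq V]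
    (G : SimpleGraph V) [DecidableRel G.Adj] (α : ℝ) (s : V) : V → ℝ :=
  ∑' ℓ : ℕ, pprHop G α s ℓ

theorem transP_apply {V : Type*} [Fintype V] [DecidableEq V]
    (G : SimpleGraph V) [DecidableRel G.Adj] (hdeg : ∀ u : V, 1 ≤ G.degree u) (v u : V) :
    transP G v u = G.adjMatrix ℝ v u * (G.degree u : ℝ)⁻¹ := by
  have hne : ∀ w : V, (G.degree w : ℝ) ≠ 0 := fun w =>
    Nat.cast_ne_zero.mpr (Nat.one_le_iff_ne_zero.mp (hdeg w))
  have hinv : (Matrix.diagonal fun w : V => (G.degree w : ℝ))⁻¹ =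
      Matrix.diagonal fun w : V => (G.degree w : ℝ)⁻¹ := by
    refine Matrix.inv_eq_right_inv ?_
    simp [Matrix.diagonal_mul_diagonal, hne]
  rw [transP, hinv, Matrix.mul_diagonal]

theorem transP_mem_colStochastic {V : Type*} [Fintype V] [DecidableEq V]
    (G : SimpleGraph V) [DecidableRel G.Adj] (hdeg : ∀ u : V, 1 ≤ G.degree u) :
    transP G ∈ Matrix.colStochastic ℝ V := by
  refine Matrix.mem_colStochastic.mpr ⟨fun v u => ?_, ?_⟩
  · rw [transP_apply G hdeg, SimpleGraph.adjMatrix_apply]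
    positivity
  · funext u
    have hne : (G.degree u : ℝ) ≠ 0 :=
      Nat.cast_ne_zero.mpr (Nat.one_le_iff_ne_zero.mp (hdeg u))
    have hcol : ∑ v, G.adjMatrix ℝ v u = G.degree u := by
      simpa [Matrix.vecMul, dotProduct] using
        SimpleGraph.adjMatrix_vecMul_apply (α := ℝ) G u (1 : V → ℝ)
    simp only [Matrix.vecMul, dotProduct, Pi.one_apply, one_mul, transP_apply G hdeg]
    rw [← Finset.sum_mul, hcol, mul_inv_cancel₀ hne]

theorem mulVec_nonneg_of_mem_colStochastic {V : Type*} [Fintype V] [DecidableEq V]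
    {M : Matrix V V ℝ} (hM : M ∈ Matrix.colStochastic ℝ V) {x : V → ℝ} (hx : ∀ v, 0 ≤ x v)
    (t : V) : 0 ≤ (M *ᵥ x) t :=
  Finset.sum_nonneg fun s _ =>
    mul_nonneg (Matrix.nonneg_of_mem_colStochastic hM) (hx s)

theorem mulVec_uniform_le_one {V : Type*} [Fintype V] [DecidableEq V] [Nonempty V]
    {M : Matrix V V ℝ} (hM : M ∈ Matrix.colStochastic ℝ V) (t : V) :
    (M *ᵥ fun _ : V => 1 / (Fintype.card V : ℝ)) t ≤ 1 := by
  have hsum : ∑ v, (M *ᵥ fun _ : V => 1 / (Fintype.card V : ℝ)) v = 1 := by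
    rw [Matrix.sum_mulVec_of_mem_colStochastic hM]
    simp
  have hnonneg : ∀ v, 0 ≤ (M *ᵥ fun _ : V => 1 / (Fintype.card V : ℝ)) v := fun v =>
    mulVec_nonneg_of_mem_colStochastic hM (fun _ => by positivity) v
  exact (Finset.single_le_sum (fun v _ => hnonneg v) (Finset.mem_univ t)).trans_eq hsum

/-- A geometrically weighted series with weights in `[0, 1]`, compared with its truncation. -/
theorem geometric_weighted_truncation {α : ℝ} (hα0 : 0 < α) (hα1 : α < 1) {x : ℕ → ℝ}
    (hx0 : ∀ i, 0 ≤ x i) (hx1 : ∀ i, x i ≤ 1) (k : ℕ) :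
    Summable (fun i => α * (1 - α) ^ i * x i) ∧
    ∑ i ∈ Finset.range k, α * (1 - α) ^ i * x i ≤ ∑' i, α * (1 - α) ^ i * x i ∧
    ∑' i, α * (1 - α) ^ i * x i ≤
      ∑ i ∈ Finset.range k, α * (1 - α) ^ i * x i + (1 - α) ^ k := by
  have hβ : 0 ≤ 1 - α := by linarith
  have hgeom : HasSum (fun i : ℕ => α * (1 - α) ^ i) 1 := by
    have h := (hasSum_geometric_of_lt_one hβ (by linarith)).mul_left α
    rwa [sub_sub_cancel, mul_inv_cancel₀ hα0.ne'] at h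
  have hnonneg : ∀ i, 0 ≤ α * (1 - α) ^ i * x i := fun i =>
    mul_nonneg (by positivity) (hx0 i)
  have hle : ∀ i, α * (1 - α) ^ i * x i ≤ α * (1 - α) ^ i := fun i =>
    mul_le_of_le_one_right (by positivity) (hx1 i)
  have hsum : Summable (fun i => α * (1 - α) ^ i * x i) :=
    Summable.of_nonneg_of_le hnonneg hle hgeom.summable
  refine ⟨hsum, hsum.sum_le_tsum _ fun i _ => hnonneg i, ?_⟩
  rw [← hsum.sum_add_tsum_nat_add k]
  gcongr
  have htail : HasSum (fun i : ℕ => α * (1 - α) ^ (i + k)) ((1 - α) ^ k) := by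
    have h := hgeom.mul_right ((1 - α) ^ k)
    simpa only [one_mul, mul_assoc, ← pow_add] using h
  rw [← htail.tsum_eq]
  exact ((summable_nat_add_iff k).mpr hsum).tsum_le_tsum (fun i => hle (i + k)) htail.summable

theorem average_pprHop_apply {V : Type*} [Fintype V] [DecidableEq V]
    (G : SimpleGraph V) [DecidableRel G.Adj] (α : ℝ) (k : ℕ) (t : V) :
    (1 / (Fintype.card V : ℝ)) * (∑ s : V, ∑ ℓ ∈ Finset.range k, pprHop G α s ℓ t) =
      ∑ ℓ ∈ Finset.range k, α * (1 - α) ^ ℓ *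
        ((transP G ^ ℓ) *ᵥ fun _ : V => 1 / (Fintype.card V : ℝ)) t := by
  rw [Finset.sum_comm, Finset.mul_sum]
  refine Finset.sum_congr rfl fun ℓ _ => ?_
  simp only [pprHop, Pi.smul_apply, smul_eq_mul, Matrix.mulVec_single_one, Matrix.col_apply,
    Matrix.mulVec, dotProduct]
  rw [← Finset.mul_sum, ← Finset.sum_mul]
  ring

theorem truncated_pagerank_approx
    {V : Type*} [Fintype V] [DecidableEq V] [Nonempty V]
    (G : SimpleGraph V) [DecidableRel G.Adj]
    (hdeg : ∀ u : V, 1 ≤ G.degree u)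
    (α : ℝ) (hα0 : 0 < α) (hα1 : α < 1) (c : ℝ) (hc : 0 < c) (L : ℕ)
    (hL : (1 - α) ^ (L + 1) ≤ c * α / (2 * (Fintype.card V : ℝ))) (t : V) :
    (1 / (Fintype.card V : ℝ)) *
        (∑ s : V, ∑ ℓ ∈ Finset.range (L + 1), pprHop G α s ℓ t) ≤ pagerank G α t ∧
    pagerank G α t ≤
      (1 / (Fintype.card V : ℝ)) *
          (∑ s : V, ∑ ℓ ∈ Finset.range (L + 1), pprHop G α s ℓ t)
        + (c / 2) * pagerank G α t := by
  set x : ℕ → V → ℝ := fun i => (transP G ^ i) *ᵥ fun _ : V => 1 / (Fintype.card V : ℝ) with hx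
  have hpow : ∀ i, transP G ^ i ∈ Matrix.colStochastic ℝ V := fun i =>
    pow_mem (transP_mem_colStochastic G hdeg) i
  have htrunc : ∀ v k, _ := fun v k => geometric_weighted_truncation hα0 hα1 (x := fun i => x i v)
    (fun i => mulVec_nonneg_of_mem_colStochastic (hpow i) (fun _ => by positivity) v)
    (fun i => mulVec_uniform_le_one (hpow i) v) k
  have hpr : pagerank G α t = ∑' i, α * (1 - α) ^ i * x i t :=
    tsum_apply (Pi.summable.mpr fun v => (htrunc v 0).1)
  have hfirst : α / Fintype.card V ≤ pagerank G α t := by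
    have h := (htrunc t 1).2.1
    rw [← hpr] at h
    simpa [hx, div_eq_mul_inv] using h
  obtain ⟨-, hlower, hupper⟩ := htrunc t (L + 1)
  rw [average_pprHop_apply]
  refine ⟨hpr ▸ hlower, (hpr ▸ hupper).trans (add_le_add le_rfl (hL.trans ?_))⟩
  calc c * α / (2 * (Fintype.card V : ℝ)) = c / 2 * (α / Fintype.card V) := by ring
    _ ≤ c / 2 * pagerank G α t := by gcongr
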